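/- arXiv:1704.04757 — 3 statements merged into one kernel-verified Lean document; each statement's English description precedes it below -/
import Mathlib

section
/- Let φ ∈ L¹([0,1], r dr) and let (a_n)_{n≥1} be a strictly increasing sequence of integers with a_n ≥ 2 for all n and Σ_n 1/a_n = ∞. If φ̂(a_n) = 0 for all n, then φ̂(z) = 0 for every complex z with Re z > 2, and φ = 0 almost everywhere on [0,1]. -/
open MeasureTheory Complex

noncomputable section

/-- The Mellin transform `φ̂(z) = ∫₀¹ φ(r) r^{z−1} dr`. -/
def mellinT (φ : ℝ → ℂ) (z : ℂ) : ℂ :=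
  ∫ r in Set.Ioo (0:ℝ) 1, φ r * (r : ℂ) ^ (z - 1)

/-- Membership in `L¹([0,1], r dr)`. -/
def MemL1rdr (φ : ℝ → ℂ) : Prop :=
  IntegrableOn (fun r : ℝ => r • φ r) (Set.Ioo (0:ℝ) 1)

/-- The Mellin convolution `(φ ∗_M ψ)(r) = ∫_r^1 φ(r/t) ψ(t) dt/t`. -/
def mellinConv (φ ψ : ℝ → ℂ) (r : ℝ) : ℂ :=
  ∫ t in Set.Ioo r 1, (t⁻¹ : ℝ) • (φ (r / t) * ψ t)


theorem abs_le_of_abs_mul_deriv_sub_le {P P' : ℝ → ℝ} {l : ℕ} (hl : 0 < l) {C : ℝ}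
    (hP : ∀ x, HasDerivAt P (P' x) x) (h1 : P 1 = 0) (hC : 0 ≤ C)
    (hb : ∀ x ∈ Set.Ioc (0 : ℝ) 1, |x * P' x - l * P x| ≤ l * C) :
    ∀ x ∈ Set.Ioc (0 : ℝ) 1, |P x| ≤ C := by
  have upper : ∀ (R R' : ℝ → ℝ), (∀ x, HasDerivAt R (R' x) x) → R 1 = 0 →
      (∀ x ∈ Set.Ioc (0 : ℝ) 1, -(l * C) ≤ x * R' x - l * R x) →
      ∀ x ∈ Set.Ioc (0 : ℝ) 1, R x ≤ C := by
    intro R R' hR hR1 hRb x hx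
    have hd : ∀ t : ℝ, 0 < t → HasDerivAt (fun t => (R t - C) / t ^ l)
        ((R' t * t ^ l - (R t - C) * (l * t ^ (l - 1))) / (t ^ l) ^ 2) t := fun t ht =>
      ((hR t).sub_const C).div (hasDerivAt_pow l t) (by positivity)
    have hpos : ∀ t ∈ Set.Icc x 1, 0 < t := fun t ht => hx.1.trans_le ht.1
    have hm : MonotoneOn (fun t => (R t - C) / t ^ l) (Set.Icc x 1) := by
      refine monotoneOn_of_hasDerivWithinAt_nonneg (convex_Icc x 1)
        (fun t ht => (hd t (hpos t ht)).continuousAt.continuousWithinAt)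
        (fun t ht => (hd t (hpos t (interior_subset ht))).hasDerivWithinAt) fun t ht => ?_
      have ht' := interior_subset ht
      have h0 := hpos t ht'
      have hpow : t ^ l = t * t ^ (l - 1) := by
        rw [← pow_succ', Nat.sub_add_cancel hl]
      refine div_nonneg ?_ (by positivity)
      have := hRb t ⟨h0, ht'.2⟩
      rw [hpow]
      calc (0 : ℝ) ≤ t ^ (l - 1) * (t * R' t - l * R t + l * C) :=
            mul_nonneg (by positivity) (by linarith)
        _ = _ := by ring
    have h := hm ⟨le_rfl, hx.2⟩ ⟨hx.2, le_rfl⟩ hx.2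
    simp only [hR1, one_pow, div_one] at h
    have h0 := hx.1
    have : (R x - C) / x ^ l ≤ 0 := by linarith
    have := (div_le_iff₀ (by positivity)).1 this
    linarith
  intro x hx
  refine abs_le'.2 ⟨upper P P' hP h1 (fun t ht => (abs_le.1 (hb t ht)).1) x hx,
    upper (fun t => -P t) (fun t => -P' t) (fun t => (hP t).neg) (by simp [h1]) (fun t ht => ?_) x hx⟩
  have := (abs_le.1 (hb t ht)).2
  linarith

/-- Golitschek's approximation: `x ^ q` is approximated on `(0, 1]` by combinations of the
`x ^ l k`, `k < n`, with error at most `∏ k < n, (1 - q / l k)`. -/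
theorem exists_abs_pow_sub_sum_le (q : ℕ) (l : ℕ → ℕ) (hl : StrictMono l) (hq : ∀ k, q < l k)
    (n : ℕ) : ∃ c : ℕ → ℝ, ∀ x ∈ Set.Ioc (0 : ℝ) 1,
      |x ^ q - ∑ k ∈ Finset.range n, c k * x ^ l k| ≤
        ∏ k ∈ Finset.range n, (1 - (q : ℝ) / l k) := by
  induction n with
  | zero =>
    refine ⟨0, fun x hx => ?_⟩
    have := hx.1
    simpa [abs_of_nonneg (pow_nonneg this.le q)] using pow_le_one₀ this.le hx.2
  | succ n ih =>
    obtain ⟨c, hc⟩ := ih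
    set M : ℝ := ∏ k ∈ Finset.range n, (1 - (q : ℝ) / l k)
    set L : ℕ := l n
    have hqL : (q : ℝ) < L := by exact_mod_cast hq n
    have hL : 0 < L := (Nat.zero_le q).trans_lt (hq n)
    have hL' : (0 : ℝ) < L := by exact_mod_cast hL
    have hM : 0 ≤ M := (abs_nonneg _).trans (hc 1 (by simp))
    set d : ℕ → ℝ := fun k => c k * ((L - q) / (L - l k))
    have hd : ∀ k ∈ Finset.range n, d k * (l k - L) = c k * (q - L) := by
      intro k hk
      have : (l k : ℝ) < L := by exact_mod_cast hl (Finset.mem_range.1 hk)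
      have : (L : ℝ) - l k ≠ 0 := by linarith
      simp only [d]
      field_simp
      ring
    have key : ∀ x ∈ Set.Ioc (0 : ℝ) 1,
        |(x ^ q - x ^ L) - ∑ k ∈ Finset.range n, d k * (x ^ l k - x ^ L)| ≤
          M * (1 - (q : ℝ) / L) := by
      refine abs_le_of_abs_mul_deriv_sub_le (l := L) hL
        (P := fun x => (x ^ q - x ^ L) - ∑ k ∈ Finset.range n, d k * (x ^ l k - x ^ L))
        (P' := fun x => (q * x ^ (q - 1) - L * x ^ (L - 1)) -
          ∑ k ∈ Finset.range n, d k * (l k * x ^ (l k - 1) - L * x ^ (L - 1)))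
        (fun x => ?_) (by simp) ?_ fun x hx => ?_
      · exact ((hasDerivAt_pow q x).sub (hasDerivAt_pow L x)).sub
          (HasDerivAt.fun_sum fun k _ =>
            ((hasDerivAt_pow (l k) x).sub (hasDerivAt_pow L x)).const_mul (d k))
      · refine mul_nonneg hM ?_
        rw [sub_nonneg, div_le_one hL']
        exact hqL.le
      · have hx_pow : ∀ m : ℕ, x * (m * x ^ (m - 1)) = m * x ^ m := by
          rintro (_ | m)
          · simp
          · simp only [Nat.add_sub_cancel]; ring
        have hmono : ∀ m : ℕ, x * (m * x ^ (m - 1) - L * x ^ (L - 1)) - L * (x ^ m - x ^ L) =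
            (m - L) * x ^ m := by
          intro m
          rw [mul_sub, hx_pow, hx_pow]; ring
        have hsum : x * ∑ k ∈ Finset.range n, d k * (l k * x ^ (l k - 1) - L * x ^ (L - 1)) -
            L * ∑ k ∈ Finset.range n, d k * (x ^ l k - x ^ L) =
            (q - L) * ∑ k ∈ Finset.range n, c k * x ^ l k := by
          simp only [Finset.mul_sum]
          rw [← Finset.sum_sub_distrib]
          refine Finset.sum_congr rfl fun k hk => ?_
          linear_combination d k * hmono (l k) + x ^ l k * hd k hk
        have heq : x * ((q * x ^ (q - 1) - L * x ^ (L - 1)) -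
            ∑ k ∈ Finset.range n, d k * (l k * x ^ (l k - 1) - L * x ^ (L - 1))) -
            L * ((x ^ q - x ^ L) - ∑ k ∈ Finset.range n, d k * (x ^ l k - x ^ L)) =
            (q - L) * (x ^ q - ∑ k ∈ Finset.range n, c k * x ^ l k) := by
          linear_combination hmono q - hsum
        rw [heq, abs_mul, abs_of_neg (by linarith : (q : ℝ) - L < 0)]
        calc -((q : ℝ) - L) * |x ^ q - ∑ k ∈ Finset.range n, c k * x ^ l k|
            ≤ -((q : ℝ) - L) * M := mul_le_mul_of_nonneg_left (hc x hx) (by linarith)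
          _ = L * (M * (1 - q / L)) := by field_simp; ring
    refine ⟨fun k => if k < n then d k else 1 - ∑ j ∈ Finset.range n, d j, fun x hx => ?_⟩
    rw [Finset.prod_range_succ, Finset.sum_range_succ]
    convert key x hx using 2
    have : ∑ k ∈ Finset.range n, (if k < n then d k else 1 - ∑ j ∈ Finset.range n, d j) * x ^ l k =
        ∑ k ∈ Finset.range n, d k * x ^ l k :=
      Finset.sum_congr rfl fun k hk => by rw [if_pos (Finset.mem_range.1 hk)]
    rw [this]
    simp only [lt_irrefl, if_false, mul_sub, Finset.sum_sub_distrib, ← Finset.sum_mul]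
    ring

theorem tendsto_prod_one_sub_div_zero {q : ℕ} (hq0 : 0 < q) {l : ℕ → ℕ} (hq : ∀ k, q < l k)
    (hdiv : ¬ Summable (fun k => (1 : ℝ) / l k)) :
    Filter.Tendsto (fun n => ∏ k ∈ Finset.range n, (1 - (q : ℝ) / l k)) Filter.atTop (nhds 0) := by
  have hS := (not_summable_iff_tendsto_nat_atTop_of_nonneg
    (fun k => by positivity : ∀ k, 0 ≤ (1 : ℝ) / l k)).1 hdiv
  have hE := Real.tendsto_exp_neg_atTop_nhds_zero.comp
    (hS.const_mul_atTop (by exact_mod_cast hq0 : (0 : ℝ) < q))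
  have h0 : ∀ k, 0 ≤ 1 - (q : ℝ) / l k := fun k => by
    have h : (q : ℝ) < l k := by exact_mod_cast hq k
    rw [sub_nonneg, div_le_one ((Nat.cast_nonneg q).trans_lt h)]
    exact h.le
  refine squeeze_zero (fun n => Finset.prod_nonneg fun k _ => h0 k) (fun n => ?_) hE
  simp only [Function.comp_apply, Finset.mul_sum, ← Finset.sum_neg_distrib, Real.exp_sum]
  refine Finset.prod_le_prod (fun k _ => h0 k) fun k _ => ?_
  have := Real.add_one_le_exp (-((q : ℝ) * (1 / l k)))
  linarith [mul_one_div (q : ℝ) (l k)]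

theorem integrableOn_Ioo_smul_of_continuous {f : ℝ → ℂ} (hf : IntegrableOn f (Set.Ioo (0 : ℝ) 1))
    {p : ℝ → ℝ} (hp : Continuous p) : IntegrableOn (fun x => p x • f x) (Set.Ioo (0 : ℝ) 1) := by
  obtain ⟨C, hC⟩ := isCompact_Icc.exists_bound_of_continuousOn
    (hp.continuousOn (s := Set.Icc (0 : ℝ) 1))
  refine hf.bdd_smul C hp.aestronglyMeasurable ?_
  exact (ae_restrict_mem measurableSet_Ioo).mono fun x hx => hC x (Set.Ioo_subset_Icc_self hx)

theorem norm_setIntegral_smul_le {f : ℝ → ℂ} (hf : IntegrableOn f (Set.Ioo (0 : ℝ) 1))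
    {p : ℝ → ℝ} {C : ℝ} (hC : ∀ x ∈ Set.Ioo (0 : ℝ) 1, |p x| ≤ C) :
    ‖∫ x in Set.Ioo (0 : ℝ) 1, p x • f x‖ ≤ C * ∫ x in Set.Ioo (0 : ℝ) 1, ‖f x‖ := by
  rw [← integral_const_mul]
  refine norm_integral_le_of_norm_le (hf.norm.const_mul C) ?_
  refine (ae_restrict_mem measurableSet_Ioo).mono fun x hx => ?_
  rw [norm_smul, Real.norm_eq_abs]
  exact mul_le_mul_of_nonneg_right (hC x hx) (norm_nonneg _)

/-- The moments of an integrable function of positive order vanish as soon as those along a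
sequence with divergent sum of reciprocals do. -/
theorem setIntegral_pow_smul_eq_zero {f : ℝ → ℂ} (hf : IntegrableOn f (Set.Ioo (0 : ℝ) 1))
    {q : ℕ} (hq0 : 0 < q) {l : ℕ → ℕ} (hl : StrictMono l) (hq : ∀ k, q < l k)
    (hdiv : ¬ Summable (fun k => (1 : ℝ) / l k))
    (hzero : ∀ k, ∫ x in Set.Ioo (0 : ℝ) 1, x ^ l k • f x = 0) :
    ∫ x in Set.Ioo (0 : ℝ) 1, x ^ q • f x = 0 := by
  have hlim := (tendsto_prod_one_sub_div_zero hq0 hq hdiv).mul_const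
    (∫ x in Set.Ioo (0 : ℝ) 1, ‖f x‖)
  rw [zero_mul] at hlim
  refine norm_le_zero_iff.1 (ge_of_tendsto' hlim fun n => ?_)
  obtain ⟨c, hc⟩ := exists_abs_pow_sub_sum_le q l hl hq n
  have hint : ∀ k ∈ Finset.range n,
      IntegrableOn (fun x : ℝ => c k • (x ^ l k • f x)) (Set.Ioo (0 : ℝ) 1) := fun k _ =>
    (integrableOn_Ioo_smul_of_continuous hf (continuous_pow (l k))).smul (c k)
  have heq : ∫ x in Set.Ioo (0 : ℝ) 1, x ^ q • f x =
      ∫ x in Set.Ioo (0 : ℝ) 1, (x ^ q - ∑ k ∈ Finset.range n, c k * x ^ l k) • f x := by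
    simp only [sub_smul, Finset.sum_smul, mul_smul]
    rw [integral_sub (integrableOn_Ioo_smul_of_continuous hf (continuous_pow q))
      (integrable_finsetSum _ hint), integral_finsetSum _ hint]
    simp only [integral_smul, hzero, smul_zero, Finset.sum_const_zero, sub_zero]
  rw [heq]
  exact norm_setIntegral_smul_le hf fun x hx => hc x ⟨hx.1, hx.2.le⟩

theorem ae_eq_zero_of_forall_setIntegral_pow_smul_eq_zero {f : ℝ → ℂ}
    (hf : IntegrableOn f (Set.Ioo (0 : ℝ) 1))
    (hzero : ∀ k : ℕ, ∫ x in Set.Ioo (0 : ℝ) 1, x ^ k • f x = 0) :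
    ∀ᵐ x ∂(volume.restrict (Set.Ioo (0 : ℝ) 1)), f x = 0 := by
  have hpoly : ∀ p : Polynomial ℝ, ∫ x in Set.Ioo (0 : ℝ) 1, p.eval x • f x = 0 := by
    intro p
    simp only [Polynomial.eval_eq_sum_range, Finset.sum_smul, mul_smul]
    have hint : ∀ k ∈ Finset.range (p.natDegree + 1),
        IntegrableOn (fun x : ℝ => p.coeff k • (x ^ k • f x)) (Set.Ioo (0 : ℝ) 1) := fun k _ =>
      (integrableOn_Ioo_smul_of_continuous hf (continuous_pow k)).smul (p.coeff k)
    rw [integral_finsetSum _ hint]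
    simp only [integral_smul, hzero, smul_zero, Finset.sum_const_zero]
  rw [ae_restrict_iff' measurableSet_Ioo]
  refine isOpen_Ioo.ae_eq_zero_of_integral_contDiff_smul_eq_zero hf.locallyIntegrableOn ?_
  intro g hg _ hsupp
  have hset : ∫ x, g x • f x = ∫ x in Set.Ioo (0 : ℝ) 1, g x • f x := by
    refine (setIntegral_eq_integral_of_forall_compl_eq_zero fun x hx => ?_).symm
    rw [image_eq_zero_of_notMem_tsupport fun h => hx (hsupp h), zero_smul]
  rw [hset]
  have hlim : Filter.Tendsto (fun ε : ℝ => ε * ∫ x in Set.Ioo (0 : ℝ) 1, ‖f x‖)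
      (nhdsWithin 0 (Set.Ioi 0)) (nhds 0) := by
    simpa using ((Filter.tendsto_id (x := nhds (0 : ℝ))).mul_const
      (∫ x in Set.Ioo (0 : ℝ) 1, ‖f x‖)).mono_left nhdsWithin_le_nhds
  refine norm_le_zero_iff.1 (ge_of_tendsto hlim (eventually_mem_nhdsWithin.mono fun ε hε => ?_))
  obtain ⟨p, hp⟩ := exists_polynomial_near_of_continuousOn 0 1 g hg.continuous.continuousOn ε hε
  have heq : ∫ x in Set.Ioo (0 : ℝ) 1, g x • f x =
      ∫ x in Set.Ioo (0 : ℝ) 1, (g x - p.eval x) • f x := by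
    simp only [sub_smul]
    rw [integral_sub (integrableOn_Ioo_smul_of_continuous hf hg.continuous)
      (integrableOn_Ioo_smul_of_continuous hf p.continuous), hpoly, sub_zero]
  rw [heq]
  refine norm_setIntegral_smul_le hf fun x hx => ?_
  rw [abs_sub_comm]
  exact (hp x (Set.Ioo_subset_Icc_self hx)).le

theorem mellinT_natCast_add_two (φ : ℝ → ℂ) (m : ℕ) :
    mellinT φ ((m + 2 : ℕ) : ℂ) = ∫ r in Set.Ioo (0 : ℝ) 1, r ^ m • (r • φ r) := by
  refine setIntegral_congr_fun measurableSet_Ioo fun r _ => ?_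
  have h : ((m + 2 : ℕ) : ℂ) - 1 = ((m + 1 : ℕ) : ℂ) := by push_cast; ring
  simp only [h, cpow_natCast, real_smul, ofReal_pow]
  ring

/-- A function in `L¹([0,1], r dr)` whose Mellin transform vanishes on a sequence of integers
`(a_n)`, `a_n ≥ 2`, with `Σ 1/a_n = ∞`, has identically vanishing Mellin transform on
`{Re z > 2}` and is zero almost everywhere. -/
theorem mellin_vanishing_on_sequence (φ : ℝ → ℂ) (hφ : MemL1rdr φ) (a : ℕ → ℕ)
    (ha2 : ∀ n, 2 ≤ a n) (hmono : StrictMono a)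
    (hdiv : ¬ Summable (fun n => (1 : ℝ) / (a n)))
    (hzero : ∀ n, mellinT φ ((a n : ℂ)) = 0) :
    (∀ z : ℂ, 2 < z.re → mellinT φ z = 0) ∧
      (∀ᵐ r ∂(volume.restrict (Set.Ioo (0:ℝ) 1)), φ r = 0) := by
  have hae : ∀ᵐ r ∂(volume.restrict (Set.Ioo (0 : ℝ) 1)), φ r = 0 := by
    have hmoment : ∀ q : ℕ, 0 < q →
        ∫ r in Set.Ioo (0 : ℝ) 1, r ^ q • (r • φ r) = 0 := by
      intro q hq0
      have hle : ∀ k, k ≤ a k := fun k => hmono.le_apply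
      refine setIntegral_pow_smul_eq_zero hφ hq0 (l := fun k => a (k + (q + 3)) - 2)
        (fun i j hij => ?_) (fun k => ?_) (fun hs => hdiv ?_) fun k => ?_
      · have h := hmono (Nat.add_lt_add_right hij (q + 3))
        have := ha2 (i + (q + 3))
        dsimp only
        omega
      · have := hle (k + (q + 3))
        omega
      · refine (summable_nat_add_iff (q + 3)).1 (hs.of_nonneg_of_le (fun k => by positivity)
          fun k => one_div_le_one_div_of_le ?_ ?_)
        · have := hle (k + (q + 3))
          exact_mod_cast (by omega : 0 < a (k + (q + 3)) - 2)
        · exact_mod_cast Nat.sub_le _ 2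
      · rw [← mellinT_natCast_add_two, Nat.sub_add_cancel (ha2 _)]
        exact hzero _
    have hint : IntegrableOn (fun r : ℝ => r • (r • φ r)) (Set.Ioo (0 : ℝ) 1) :=
      integrableOn_Ioo_smul_of_continuous hφ continuous_id
    have h := ae_eq_zero_of_forall_setIntegral_pow_smul_eq_zero hint fun k => by
      simpa only [pow_succ, mul_smul] using hmoment (k + 1) k.succ_pos
    filter_upwards [h, ae_restrict_mem measurableSet_Ioo] with r hr hmem
    simpa [hmem.1.ne'] using hr
  refine ⟨fun z _ => integral_eq_zero_of_ae ?_, hae⟩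
  filter_upwards [hae] with r hr
  simp [hr]

end
end

section
/- Let p > 0 be a real number and let H be a bounded analytic function on the half-plane {z ∈ ℂ : Re z > 2} such that H(z + p) = H(z) for all z with Re z > 2. Then H is constant. -/
open MeasureTheory Complex

noncomputable section

/-- A bounded holomorphic function on a right half-plane varies little between points which are
close compared with their distance to the boundary. -/
theorem dist_le_of_bounded_on_halfPlane {H : ℂ → ℂ} {a C : ℝ}
    (hH : DifferentiableOn ℂ H {z : ℂ | a < z.re}) (hb : ∀ z : ℂ, a < z.re → ‖H z‖ ≤ C)
    {z w : ℂ} (h : dist w z < z.re - a) :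
    dist (H w) (H z) ≤ 2 * C / (z.re - a) * dist w z := by
  have hsub : Metric.ball z (z.re - a) ⊆ {u : ℂ | a < u.re} := by
    intro u hu
    have h1 := (abs_re_le_norm (u - z)).trans_lt (mem_ball_iff_norm.mp hu)
    have h2 := (abs_lt.mp h1).1
    simp only [sub_re, Set.mem_ofPred_eq] at h2 ⊢
    linarith
  have hz : a < z.re := by linarith [dist_nonneg (x := w) (y := z)]
  refine Complex.dist_le_div_mul_dist_of_mapsTo_ball (hH.mono hsub) (fun u hu => ?_) h
  rw [mem_closedBall_iff_norm]
  linarith [norm_sub_le (H u) (H z), hb u (hsub hu), hb z hz]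

/-- A bounded analytic function on `{Re z > 2}` that is periodic with a real period `p > 0`
is constant. -/
theorem bounded_periodic_analytic_constant (p : ℝ) (hp : 0 < p) (H : ℂ → ℂ)
    (hH : DifferentiableOn ℂ H {z : ℂ | 2 < z.re})
    (hb : ∃ C : ℝ, ∀ z : ℂ, 2 < z.re → ‖H z‖ ≤ C)
    (hper : ∀ z : ℂ, 2 < z.re → H (z + (p : ℂ)) = H z) :
    ∃ c : ℂ, ∀ z : ℂ, 2 < z.re → H z = c := by
  obtain ⟨C, hC⟩ := hb
  have hshift (n : ℕ) (z : ℂ) (hz : 2 < z.re) : H (z + n * p) = H z := by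
    induction n with
    | zero => simp
    | succ n ih =>
      rw [← ih, ← hper (z + n * p)]
      · push_cast
        ring_nf
      · simp only [add_re, mul_re, natCast_re, ofReal_re, natCast_im, ofReal_im]
        nlinarith [mul_nonneg n.cast_nonneg hp.le]
  refine ⟨H 3, fun w hw => ?_⟩
  have hlim : Filter.Tendsto (fun n : ℕ => 1 + (n : ℝ) * p) Filter.atTop Filter.atTop :=
    Filter.tendsto_atTop_add_const_left _ _ (tendsto_natCast_atTop_atTop.atTop_mul_const hp)
  have h0 := (hlim.const_div_atTop (2 * C)).mul_const (dist w 3)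
  rw [zero_mul] at h0
  refine dist_le_zero.mp (ge_of_tendsto h0 ?_)
  filter_upwards [hlim.eventually_gt_atTop (dist w 3)] with n hn
  have hre : (3 + (n : ℂ) * p).re - 2 = 1 + n * p := by
    simp
    ring
  have hd : dist (w + n * p) (3 + n * p) = dist w 3 := dist_add_right _ _ _
  have key := dist_le_of_bounded_on_halfPlane hH hC (by rwa [hd, hre])
  rwa [hd, hre, hshift n w hw, hshift n 3 (by norm_num)] at key

end
end

section
/- Let N ≥ 3 be an odd integer, let c_N, c_{N−4} ∈ ℂ, and define f_*(r) = −4c_N r²(1 − r^{2N})/(1 − r⁴). Suppose g ∈ L¹([0,1], r dr) satisfies the functional equation (z+2N−2)·ĝ(z+N+2) − (z+2N−6)·ĝ(z+N−2) = c_N[ (z+2N−2)/(z+2N+2) − (z−2)/(z+2) ] for all z with Re z ≥ 4 (where ĝ denotes the Mellin transform of g). Then there is a constant c_{N−4} such that g(r) = c_{N−4} r^{N−4} + r^{−(N−2)} (r^{2N−6} ∗_M f_*)(r) for almost every r ∈ (0,1). -/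
open MeasureTheory Complex

noncomputable section

lemma ae_eq_zero_of_integral_mul_pow_four_eq_zero {φ : ℝ → ℂ}
    (hφ : IntegrableOn φ (Set.Ioo 0 1))
    (h : ∀ n : ℕ, ∫ r in Set.Ioo (0:ℝ) 1, φ r * (r : ℂ) ^ (4 * n) = 0) :
    ∀ᵐ r ∂(volume.restrict (Set.Ioo (0:ℝ) 1)), φ r = 0 := by
  have hmul : ∀ f : ℝ → ℝ, Continuous f →
      IntegrableOn (fun r => f r • φ r) (Set.Ioo (0:ℝ) 1) := fun f hf =>
    (((integrableOn_Icc_iff_integrableOn_Ioo (by simp) (by simp)).2 hφ).continuousOn_smul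
      hf.continuousOn isCompact_Icc).mono_set Set.Ioo_subset_Icc_self
  have hpoly : ∀ p : Polynomial ℝ,
      ∫ r in Set.Ioo (0:ℝ) 1, p.eval (r ^ 4) • φ r = 0 := by
    intro p
    induction p using Polynomial.induction_on' with
    | add p q hp hq =>
      simp only [Polynomial.eval_add, add_smul]
      rw [integral_add (hmul _ (by fun_prop)) (hmul _ (by fun_prop)), hp, hq, add_zero]
    | monomial n a =>
      rw [← mul_zero (a : ℂ), ← h n, ← integral_const_mul]
      congr 1 with r
      simp only [Polynomial.eval_monomial, Complex.real_smul]
      push_cast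
      ring
  have hcont : ∀ f : ℝ → ℝ, Continuous f → ∫ r in Set.Ioo (0:ℝ) 1, f r • φ r = 0 := by
    intro f hf
    set I := ∫ r in Set.Ioo (0:ℝ) 1, ‖φ r‖ with hI
    have hI0 : 0 ≤ I := integral_nonneg fun _ => norm_nonneg _
    rw [← norm_le_zero_iff]
    refine le_of_forall_pos_le_add fun ε hε => ?_
    obtain ⟨p, hp⟩ := exists_polynomial_near_of_continuousOn 0 1
      (fun x => f (x ^ (1 / 4 : ℝ)))
      (hf.comp (Real.continuous_rpow_const (by norm_num))).continuousOn
      (ε / (I + 1)) (by positivity)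
    have key : ∫ r in Set.Ioo (0:ℝ) 1, f r • φ r
        = ∫ r in Set.Ioo (0:ℝ) 1, (f r - p.eval (r ^ 4)) • φ r := by
      simp only [sub_smul]
      rw [integral_sub (hmul _ hf) (hmul _ (by fun_prop)), hpoly, sub_zero]
    calc ‖∫ r in Set.Ioo (0:ℝ) 1, f r • φ r‖
        ≤ ∫ r in Set.Ioo (0:ℝ) 1, ε / (I + 1) * ‖φ r‖ := by
          rw [key]
          refine norm_integral_le_of_norm_le (hφ.norm.const_mul _) ?_
          filter_upwards [ae_restrict_mem measurableSet_Ioo] with r hr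
          rw [norm_smul]
          gcongr
          have h4 : (r ^ 4) ^ (1 / 4 : ℝ) = r := by
            rw [← Real.rpow_natCast, ← Real.rpow_mul hr.1.le]
            norm_num
          have := hp (r ^ 4) ⟨by positivity, pow_le_one₀ hr.1.le hr.2.le⟩
          rw [h4, abs_sub_comm] at this
          exact this.le
      _ = ε * (I / (I + 1)) := by
          rw [integral_const_mul, ← hI]
          ring
      _ ≤ ε * 1 := by
          gcongr
          exact (div_le_one (by positivity)).2 (by linarith)
      _ = 0 + ε := by ring
  rw [ae_restrict_iff' measurableSet_Ioo]
  refine isOpen_Ioo.ae_eq_zero_of_integral_contDiff_smul_eq_zero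
    hφ.locallyIntegrableOn fun f hf _ hsupp => ?_
  rw [← hcont f hf.continuous]
  refine (setIntegral_eq_integral_of_forall_compl_eq_zero fun r hr => ?_).symm
  rw [image_eq_zero_of_notMem_tsupport fun hr' => hr (hsupp hr'), zero_smul]

lemma mellinConv_pow (k : ℕ) (F : ℝ → ℂ) {r : ℝ} (hr : r ∈ Set.Ioo (0:ℝ) 1) :
    mellinConv (fun t : ℝ => (t : ℂ) ^ k) F r
      = (r : ℂ) ^ k * ∫ t in r..1, F t / (t : ℂ) ^ (k + 1) := by
  rw [mellinConv, intervalIntegral.integral_of_le hr.2.le, integral_Ioc_eq_integral_Ioo,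
    ← integral_const_mul]
  refine setIntegral_congr_fun measurableSet_Ioo fun t ht => ?_
  have ht0 : (t : ℂ) ≠ 0 := by exact_mod_cast (hr.1.trans ht.1).ne'
  simp only [Complex.real_smul]
  push_cast
  rw [div_pow]
  field_simp
  ring

lemma hasDerivAt_mellinConv_pow (k : ℕ) {F : ℝ → ℂ} (hF : Continuous F) {r : ℝ}
    (hr : r ∈ Set.Ioo (0:ℝ) 1) :
    HasDerivAt (mellinConv (fun t : ℝ => (t : ℂ) ^ k) F)
      ((k * mellinConv (fun t : ℝ => (t : ℂ) ^ k) F r - F r) / r) r := by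
  have hr0 : (r : ℂ) ≠ 0 := by exact_mod_cast hr.1.ne'
  have hcont : ContinuousOn (fun t : ℝ => F t / (t : ℂ) ^ (k + 1)) (Set.Ioi 0) := by
    refine hF.continuousOn.div (by fun_prop) fun t ht => pow_ne_zero _ ?_
    exact_mod_cast (ne_of_gt ht)
  have hint : HasDerivAt (fun s : ℝ => ∫ t in s..1, F t / (t : ℂ) ^ (k + 1))
      (-(F r / (r : ℂ) ^ (k + 1))) r := by
    refine intervalIntegral.integral_hasDerivAt_left ?_ ?_ ?_
    · refine (hcont.mono fun t ht => ?_).intervalIntegrable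
      rw [Set.uIcc_of_le hr.2.le] at ht
      exact hr.1.trans_le ht.1
    · exact hcont.stronglyMeasurableAtFilter isOpen_Ioi r hr.1
    · exact hcont.continuousAt (Ioi_mem_nhds hr.1)
  have hpow : HasDerivAt (fun s : ℝ => (s : ℂ) ^ k) (k * (r : ℂ) ^ (k - 1)) r := by
    simpa using (hasDerivAt_pow k (r : ℂ)).comp_ofReal
  have heq : mellinConv (fun t : ℝ => (t : ℂ) ^ k) F =ᶠ[nhds r]
      fun s : ℝ => (s : ℂ) ^ k * ∫ t in s..1, F t / (t : ℂ) ^ (k + 1) :=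
    Filter.eventually_of_mem (isOpen_Ioo.mem_nhds hr) fun s hs => mellinConv_pow k F hs
  refine ((hpow.mul hint).congr_of_eventuallyEq heq).congr_deriv ?_
  rw [mellinConv_pow k F hr]
  rcases k with _ | k
  · simp
    ring
  · simp only [Nat.add_sub_cancel]
    field_simp
    ring

lemma norm_mellinConv_pow_le (k : ℕ) {F : ℝ → ℂ} {B : ℝ}
    (hF : ∀ t ∈ Set.Ioo (0:ℝ) 1, ‖F t‖ ≤ B * t) {r : ℝ} (hr : r ∈ Set.Ioo (0:ℝ) 1) :
    ‖mellinConv (fun t : ℝ => (t : ℂ) ^ k) F r‖ ≤ B * (1 - r) := by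
  have hvol : (volume : Measure ℝ).real (Set.Ioo r 1) = 1 - r := by
    simp [Real.volume_real_Ioo_of_le hr.2.le]
  rw [← hvol]
  refine norm_setIntegral_le_of_norm_le_const (by simp) fun t ht => ?_
  have ht0 : 0 < t := hr.1.trans ht.1
  have hle : r / t ≤ 1 := (div_le_one ht0).2 ht.1.le
  have hrt : 0 ≤ r / t := div_nonneg hr.1.le ht0.le
  rw [norm_smul, norm_mul, norm_pow, Complex.norm_real, Real.norm_of_nonneg hrt,
    Real.norm_of_nonneg (inv_nonneg.2 ht0.le)]
  calc t⁻¹ * ((r / t) ^ k * ‖F t‖) ≤ t⁻¹ * (1 * (B * t)) := by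
        gcongr
        · exact pow_le_one₀ hrt hle
        · exact hF t ⟨ht0, ht.2⟩
    _ = B := by field_simp

lemma integrableOn_mellinConv_pow (k : ℕ) {F : ℝ → ℂ} (hFc : Continuous F) {B : ℝ} (hB : 0 ≤ B)
    (hF : ∀ t ∈ Set.Ioo (0:ℝ) 1, ‖F t‖ ≤ B * t) :
    IntegrableOn (mellinConv (fun t : ℝ => (t : ℂ) ^ k) F) (Set.Ioo 0 1) := by
  have hcont : ContinuousOn (mellinConv (fun t : ℝ => (t : ℂ) ^ k) F) (Set.Ioo 0 1) :=
    fun r hr => (hasDerivAt_mellinConv_pow k hFc hr).continuousAt.continuousWithinAt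
  refine IntegrableOn.of_bound (by simp) (hcont.aestronglyMeasurable measurableSet_Ioo) B ?_
  filter_upwards [ae_restrict_mem measurableSet_Ioo] with r hr
  exact (norm_mellinConv_pow_le k hF hr).trans
    (mul_le_of_le_one_right hB (by linarith [hr.1]))

lemma integrableOn_mul_pow {φ : ℝ → ℂ} (hφ : IntegrableOn φ (Set.Ioo 0 1)) (m : ℕ) :
    IntegrableOn (fun r => φ r * (r : ℂ) ^ m) (Set.Ioo 0 1) :=
  (((integrableOn_Icc_iff_integrableOn_Ioo (by simp) (by simp)).2 hφ).mul_continuousOn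
    (g' := fun r : ℝ => (r : ℂ) ^ m) (by fun_prop) isCompact_Icc).mono_set Set.Ioo_subset_Icc_self

lemma integral_mellinConv_pow_mul_pow (k m : ℕ) {F : ℝ → ℂ} (hFc : Continuous F) {B : ℝ}
    (hB : 0 ≤ B) (hF : ∀ t ∈ Set.Ioo (0:ℝ) 1, ‖F t‖ ≤ B * t) :
    ((m : ℂ) + 1 + k) * ∫ r in Set.Ioo (0:ℝ) 1,
        mellinConv (fun t : ℝ => (t : ℂ) ^ k) F r * (r : ℂ) ^ m
      = ∫ r in Set.Ioo (0:ℝ) 1, F r * (r : ℂ) ^ m := by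
  set C := mellinConv (fun t : ℝ => (t : ℂ) ^ k) F with hC
  have hCint := integrableOn_mul_pow (integrableOn_mellinConv_pow k hFc hB hF) m
  have hFint : IntegrableOn (fun r => F r * (r : ℂ) ^ m) (Set.Ioo (0:ℝ) 1) :=
    integrableOn_mul_pow
      ((hFc.integrableOn_Icc (a := 0) (b := 1)).mono_set Set.Ioo_subset_Icc_self) m
  rw [← sub_eq_zero, ← integral_const_mul, ← integral_sub (hCint.const_mul _) hFint,
    ← integral_Ioc_eq_integral_Ioo, ← intervalIntegral.integral_of_le zero_le_one]
  have hbound : ∀ r ∈ Set.Ioo (0:ℝ) 1, ‖(r : ℂ) ^ (m + 1) * C r‖ ≤ r * (B * (1 - r)) := by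
    intro r hr
    rw [norm_mul, norm_pow, Complex.norm_real, Real.norm_of_nonneg hr.1.le]
    have := norm_mellinConv_pow_le k hF hr
    gcongr
    · exact hr.1.le
    · exact pow_le_of_le_one hr.1.le hr.2.le (by simp)
  have hlim : Continuous fun r : ℝ => r * (B * (1 - r)) := by fun_prop
  rw [intervalIntegral.integral_eq_sub_of_hasDerivAt_of_tendsto
    (f := fun r : ℝ => (r : ℂ) ^ (m + 1) * C r) (fa := 0) (fb := 0) zero_lt_one, sub_zero]
  · intro r hr
    have hr0 : (r : ℂ) ≠ 0 := by exact_mod_cast hr.1.ne'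
    have hpow : HasDerivAt (fun s : ℝ => (s : ℂ) ^ (m + 1))
        ((m + 1 : ℕ) * (r : ℂ) ^ m) r := by
      simpa using (hasDerivAt_pow (m + 1) (r : ℂ)).comp_ofReal
    refine (hpow.mul (hasDerivAt_mellinConv_pow k hFc hr)).congr_deriv ?_
    rw [← hC]
    push_cast
    field_simp
    ring
  · rw [intervalIntegrable_iff_integrableOn_Ioo_of_le zero_le_one]
    exact (hCint.const_mul _).sub hFint
  · refine squeeze_zero_norm' (Filter.eventually_of_mem (Ioo_mem_nhdsGT one_pos) hbound) ?_
    simpa using (hlim.tendsto 0).mono_left nhdsWithin_le_nhds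
  · refine squeeze_zero_norm' (Filter.eventually_of_mem (Ioo_mem_nhdsLT one_pos) hbound) ?_
    simpa using (hlim.tendsto 1).mono_left nhdsWithin_le_nhds

lemma mellinT_natCast (g : ℝ → ℂ) (m : ℕ) (z : ℂ) (hz : z = m + 1) :
    mellinT g z = ∫ r in Set.Ioo (0:ℝ) 1, g r * (r : ℂ) ^ m := by
  simp [mellinT, hz]

lemma integral_ofReal_pow (m : ℕ) :
    ∫ r in Set.Ioo (0:ℝ) 1, (r : ℂ) ^ m = 1 / ((m : ℂ) + 1) := by
  rw [← integral_Ioc_eq_integral_Ioo, ← intervalIntegral.integral_of_le zero_le_one]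
  have := integral_pow (a := 0) (b := 1) m
  simp only [← Complex.ofReal_pow]
  rw [intervalIntegral.integral_ofReal, this]
  simp


/-- The continuous extension to `ℝ` of `t ↦ t²(1 - t^{2N})/(1 - t⁴)`. -/
def geomKernel (N : ℕ) (t : ℝ) : ℝ :=
  t ^ 2 * (∑ i ∈ Finset.range N, (t ^ 2) ^ i) / (1 + t ^ 2)

lemma continuous_geomKernel (N : ℕ) : Continuous (geomKernel N) :=
  Continuous.div (by fun_prop) (by fun_prop) fun t => by positivity

lemma geomKernel_mul (N : ℕ) (t : ℝ) :
    geomKernel N t * (1 - t ^ 4) = t ^ 2 * (1 - t ^ (2 * N)) := by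
  have h := mul_neg_geom_sum (t ^ 2) N
  have h0 : 1 + t ^ 2 ≠ 0 := by positivity
  rw [pow_mul, ← h, geomKernel]
  field_simp
  ring

lemma abs_geomKernel_le (N : ℕ) {t : ℝ} (ht : t ∈ Set.Ioo (0:ℝ) 1) :
    |geomKernel N t| ≤ N * t := by
  have hS0 : 0 ≤ ∑ i ∈ Finset.range N, (t ^ 2) ^ i := by positivity
  have hS : ∑ i ∈ Finset.range N, (t ^ 2) ^ i ≤ N := by
    calc ∑ i ∈ Finset.range N, (t ^ 2) ^ i ≤ ∑ _i ∈ Finset.range N, (1 : ℝ) := by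
          gcongr
          exact pow_le_one₀ (by positivity) (pow_le_one₀ ht.1.le ht.2.le)
      _ = N := by simp
  have h2 : t ^ 2 ≤ t := pow_le_of_le_one ht.1.le ht.2.le two_ne_zero
  rw [geomKernel, abs_of_nonneg (by positivity)]
  calc _ ≤ t ^ 2 * ∑ i ∈ Finset.range N, (t ^ 2) ^ i :=
        div_le_self (by positivity) (by linarith [sq_nonneg t])
    _ ≤ t * N := by
        gcongr
        exact ht.1.le
    _ = N * t := mul_comm _ _

lemma integral_geomKernel_mul (N n : ℕ) (c : ℂ) :
    ∫ r in Set.Ioo (0:ℝ) 1, -4 * c * (geomKernel N r : ℂ) * ((r : ℂ) ^ (n + 4) - (r : ℂ) ^ n)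
      = 4 * c * (1 / ((n : ℂ) + 3) - 1 / ((n : ℂ) + 3 + 2 * N)) := by
  have hint : ∀ m : ℕ, IntegrableOn (fun r : ℝ => (r : ℂ) ^ m) (Set.Ioo 0 1) := fun m => by
    have : Continuous fun r : ℝ => (r : ℂ) ^ m := by fun_prop
    exact (this.integrableOn_Icc (a := 0) (b := 1)).mono_set Set.Ioo_subset_Icc_self
  calc _ = ∫ r in Set.Ioo (0:ℝ) 1,
        4 * c * ((r : ℂ) ^ (n + 2) - (r : ℂ) ^ (n + 2 + 2 * N)) := by
        congr 1 with r
        have h : (geomKernel N r : ℂ) * (1 - (r : ℂ) ^ 4)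
            = (r : ℂ) ^ 2 * (1 - (r : ℂ) ^ (2 * N)) := by
          exact_mod_cast congrArg Complex.ofReal (geomKernel_mul N r)
        linear_combination 4 * c * (r : ℂ) ^ n * h
    _ = _ := by
        rw [integral_const_mul, integral_sub (hint _) (hint _), integral_ofReal_pow,
          integral_ofReal_pow]
        push_cast
        ring_nf

/-- Solving the functional equation for the Mellin transform: any `g ∈ L¹([0,1], r dr)`
satisfying the difference equation is `c·r^{N−4} + r^{−(N−2)}(r^{2N−6} ∗_M f_*)`. -/
theorem functional_equation_solution (N : ℕ) (hN : 3 ≤ N) (hodd : Odd N) (cN : ℂ)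
    (g : ℝ → ℂ) (hg : MemL1rdr g)
    (heq : ∀ z : ℂ, 4 ≤ z.re →
      (z + 2 * (N : ℂ) - 2) * mellinT g (z + (N : ℂ) + 2)
          - (z + 2 * (N : ℂ) - 6) * mellinT g (z + (N : ℂ) - 2)
        = cN * ((z + 2 * (N : ℂ) - 2) / (z + 2 * (N : ℂ) + 2) - (z - 2) / (z + 2))) :
    ∃ c : ℂ, ∀ᵐ r ∂(volume.restrict (Set.Ioo (0:ℝ) 1)),
      g r = c * (r : ℂ) ^ ((N : ℤ) - 4)
        + ((r : ℂ) ^ ((N : ℤ) - 2))⁻¹ *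
            mellinConv (fun t : ℝ => (t : ℂ) ^ (2 * N - 6))
              (fun t : ℝ => (-4 * cN) * (t : ℂ) ^ 2 * (1 - (t : ℂ) ^ (2 * N))
                / (1 - (t : ℂ) ^ 4)) r := by
  obtain ⟨M, rfl⟩ := Nat.exists_eq_add_of_le' hN
  have hexp : 2 * (M + 3) - 6 = 2 * M := by omega
  rw [hexp]
  set F : ℝ → ℂ := fun t => -4 * cN * (geomKernel (M + 3) t : ℂ) with hF
  have hFc : Continuous F :=
    continuous_const.mul (Complex.continuous_ofReal.comp (continuous_geomKernel _))
  have hFB : ∀ t ∈ Set.Ioo (0:ℝ) 1, ‖F t‖ ≤ 4 * ‖cN‖ * (M + 3 : ℕ) * t := by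
    intro t ht
    have h := abs_geomKernel_le (M + 3) ht
    rw [hF, norm_mul, Complex.norm_real, Real.norm_eq_abs, norm_mul, norm_neg,
      mul_assoc (4 * ‖cN‖)]
    norm_num at h ⊢
    gcongr
  have hB : 0 ≤ 4 * ‖cN‖ * (M + 3 : ℕ) := by positivity
  set C := mellinConv (fun t : ℝ => (t : ℂ) ^ (2 * M)) F with hC
  have hconv : ∀ r ∈ Set.Ioo (0:ℝ) 1, mellinConv (fun t : ℝ => (t : ℂ) ^ (2 * M))
      (fun t : ℝ => (-4 * cN) * (t : ℂ) ^ 2 * (1 - (t : ℂ) ^ (2 * (M + 3)))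
                / (1 - (t : ℂ) ^ 4)) r = C r := by
    intro r hr
    refine setIntegral_congr_fun measurableSet_Ioo fun t ht => ?_
    have ht0 : 0 < t := hr.1.trans ht.1
    have h4 : 1 - (t : ℂ) ^ 4 ≠ 0 := by
      have : t ^ 4 < 1 := pow_lt_one₀ ht0.le ht.2 (by norm_num)
      exact_mod_cast (sub_pos.2 this).ne'
    have h : (geomKernel (M + 3) t : ℂ) * (1 - (t : ℂ) ^ 4)
        = (t : ℂ) ^ 2 * (1 - (t : ℂ) ^ (2 * (M + 3))) := by
      exact_mod_cast congrArg Complex.ofReal (geomKernel_mul (M + 3) t)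
    have h' : (-4 * cN) * (t : ℂ) ^ 2 * (1 - (t : ℂ) ^ (2 * (M + 3))) / (1 - (t : ℂ) ^ 4)
        = F t := by
      rw [div_eq_iff h4]
      linear_combination 4 * cN * h
    simp only [h']
  have hgint : IntegrableOn (fun r : ℝ => g r * (r : ℂ) ^ (M + 1)) (Set.Ioo 0 1) := by
    refine (integrableOn_mul_pow hg M).congr_fun (fun r _ => ?_) measurableSet_Ioo
    simp only [Complex.real_smul]
    ring
  have hCint : IntegrableOn C (Set.Ioo 0 1) := integrableOn_mellinConv_pow _ hFc hB hFB
  set H : ℝ → ℂ := fun r => g r * (r : ℂ) ^ (M + 1) - C r with hH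
  have hHint : IntegrableOn H (Set.Ioo 0 1) := hgint.sub hCint
  have hHmom : ∀ m : ℕ, ∫ r in Set.Ioo (0:ℝ) 1, H r * (r : ℂ) ^ m
      = (∫ r in Set.Ioo (0:ℝ) 1, g r * (r : ℂ) ^ (M + 1 + m))
        - ∫ r in Set.Ioo (0:ℝ) 1, C r * (r : ℂ) ^ m := by
    intro m
    simp only [hH, sub_mul, pow_add _ (M + 1) m, ← mul_assoc]
    exact integral_sub (integrableOn_mul_pow hgint m) (integrableOn_mul_pow hCint m)
  have hrec : ∀ n : ℕ,
      (2 * M + 8 + 4 * n) * ∫ r in Set.Ioo (0:ℝ) 1, H r * (r : ℂ) ^ (3 + 4 * n + 4)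
        = (2 * M + 4 + 4 * n) * ∫ r in Set.Ioo (0:ℝ) 1, H r * (r : ℂ) ^ (3 + 4 * n) := by
    intro n
    have hz := heq (4 + 4 * n) (by simp)
    rw [mellinT_natCast g (M + 1 + (3 + 4 * n + 4)) _ (by push_cast; ring),
      mellinT_natCast g (M + 1 + (3 + 4 * n)) _ (by push_cast; ring)] at hz
    have h1 := integral_mellinConv_pow_mul_pow (2 * M) (3 + 4 * n + 4) hFc hB hFB
    have h2 := integral_mellinConv_pow_mul_pow (2 * M) (3 + 4 * n) hFc hB hFB
    have h3 := integral_geomKernel_mul (M + 3) (3 + 4 * n) cN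
    simp only [mul_sub] at h3
    have hFint := hFc.integrableOn_Icc (a := 0) (b := 1) (μ := volume)
      |>.mono_set Set.Ioo_subset_Icc_self
    rw [integral_sub (integrableOn_mul_pow hFint _) (integrableOn_mul_pow hFint _),
      ← h1, ← h2] at h3
    rw [hHmom, hHmom]
    have hd1 : (4 * n + 2 * M + 12 : ℂ) ≠ 0 := by norm_cast
    have hd2 : (4 * n + 6 : ℂ) ≠ 0 := by norm_cast
    have hR : cN * (((4 + 4 * n : ℂ) + 2 * ((M + 3 : ℕ) : ℂ) - 2)
          / ((4 + 4 * n) + 2 * ((M + 3 : ℕ) : ℂ) + 2) - ((4 + 4 * n) - 2) / ((4 + 4 * n) + 2))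
        = 4 * cN * (1 / (((3 + 4 * n : ℕ) : ℂ) + 3))
          - 4 * cN * (1 / (((3 + 4 * n : ℕ) : ℂ) + 3 + 2 * ((M + 3 : ℕ) : ℂ))) := by
      push_cast
      rw [show (4 + 4 * n + 2 * (M + 3) + 2 : ℂ) = 4 * n + 2 * M + 12 by ring,
        show (3 + 4 * n + 3 + 2 * (M + 3) : ℂ) = 4 * n + 2 * M + 12 by ring,
        show (4 + 4 * n + 2 : ℂ) = 4 * n + 6 by ring,
        show (3 + 4 * n + 3 : ℂ) = 4 * n + 6 by ring]
      field_simp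
      ring
    rw [hR] at hz
    push_cast at hz h3
    linear_combination hz - h3
  set A : ℂ := (2 * M + 4) * ∫ r in Set.Ioo (0:ℝ) 1, H r * (r : ℂ) ^ 3 with hA
  have hmom : ∀ n : ℕ,
      (2 * M + 4 + 4 * n) * ∫ r in Set.Ioo (0:ℝ) 1, H r * (r : ℂ) ^ (3 + 4 * n) = A := by
    intro n
    induction n with
    | zero => simp [hA]
    | succ n ih =>
      rw [← ih, ← hrec n]
      push_cast
      ring_nf
  have hpowint : ∀ m : ℕ, IntegrableOn (fun r : ℝ => A * (r : ℂ) ^ m) (Set.Ioo 0 1) := fun m =>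
    integrableOn_mul_pow (φ := fun _ => A) (by simp) m
  have hzero := ae_eq_zero_of_integral_mul_pow_four_eq_zero
    (φ := fun r => (H r - A * (r : ℂ) ^ (2 * M)) * (r : ℂ) ^ 3)
    (integrableOn_mul_pow (hHint.sub (hpowint _)) 3) (by
      intro n
      have hd : (2 * M + 4 + 4 * n : ℂ) ≠ 0 := by
        norm_cast
        omega
      calc _ = ∫ r in Set.Ioo (0:ℝ) 1,
            (H r * (r : ℂ) ^ (3 + 4 * n) - A * (r : ℂ) ^ (2 * M + 3 + 4 * n)) := by
            congr 1 with r
            ring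
        _ = 0 := by
            rw [integral_sub (integrableOn_mul_pow hHint _) (hpowint _), integral_const_mul,
              integral_ofReal_pow, sub_eq_zero, ← mul_right_inj' hd, hmom]
            push_cast
            rw [show (2 * M + 3 + 4 * n + 1 : ℂ) = 2 * M + 4 + 4 * n by ring]
            field_simp)
  refine ⟨A, ?_⟩
  filter_upwards [hzero, ae_restrict_mem measurableSet_Ioo] with r hr hr01
  have hr0 : (r : ℂ) ≠ 0 := by exact_mod_cast hr01.1.ne'
  have hr' := (mul_eq_zero.1 hr).resolve_right (pow_ne_zero _ hr0)
  rw [hconv r hr01, show ((M + 3 : ℕ) : ℤ) - 4 = ((2 * M : ℕ) : ℤ) - ((M + 1 : ℕ) : ℤ) by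
      push_cast; ring,
    show ((M + 3 : ℕ) : ℤ) - 2 = ((M + 1 : ℕ) : ℤ) by push_cast; ring,
    zpow_sub₀ hr0, zpow_natCast, zpow_natCast]
  simp only [hH] at hr'
  field_simp
  linear_combination hr'

end
end
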